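/- Let F be a field, t ∈ F with t ≠ 0 and t^n ≠ 1, and n ≥ 2. Let A be an n×n matrix over F, B an (n−1)×(n−1) matrix over F, and r a row vector of length n−1 over F such that C_n⁻¹ · A · C_n equals the block matrix [[B, 0_{n−1}], [r, 1]], and such that (1 − t^n)·r = Σ_{i=1}^{n−1} (t^i − 1)·a_i, where a_i denotes the i-th row of B − I_{n−1}. Let Â be the top-left (n−1)×(n−1) block of A. Then (t^{−n} − 1)·det(Â − I_{n−1}) = (t^{−1} − 1)·det(B − I_{n−1}). -/

import Mathlib

open scoped Matrix

/-- The upper-triangular matrix `C_k` with `(i,j)` entry `1` if `i ≤ j` and `0` otherwise. -/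
def Cmat (k : ℕ) (R : Type*) [CommRing R] : Matrix (Fin k) (Fin k) R :=
  Matrix.of fun i j => if i ≤ j then 1 else 0

/-- The `(m+1)×(m+1)` block matrix `[[B, 0], [r, 1]]` built from an `m×m` matrix `B` and a
row vector `r` of length `m`. -/
def blockMat {R : Type*} [CommRing R] {m : ℕ} (B : Matrix (Fin m) (Fin m) R) (r : Fin m → R) :
    Matrix (Fin (m + 1)) (Fin (m + 1)) R :=
  Matrix.of fun i j =>
    if hi : (i : ℕ) < m then
      if hj : (j : ℕ) < m then B ⟨i, hi⟩ ⟨j, hj⟩ else 0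
    else
      if hj : (j : ℕ) < m then r ⟨j, hj⟩ else 1

lemma Cmat_det (k : ℕ) (F : Type*) [Field F] : (Cmat k F).det = 1 := by
  rw [Matrix.det_of_upperTriangular]
  · simp [Cmat]
  · intro i j hij
    have : ¬ i ≤ j := not_le.mpr hij
    simp [Cmat, this]

/-- Lemma 3 of the paper: if `C_n⁻¹ A C_n = [[B, 0], [r, 1]]` (with `n = m+1 ≥ 2`) and
`(1 - tⁿ) r = Σ_{i=1}^{n-1} (tⁱ - 1) a_i` where `a_i` is the `i`-th row of `B - I`, then
`(t⁻ⁿ - 1) det(Â - I) = (t⁻¹ - 1) det(B - I)` where `Â` is the top-left block of `A`. -/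
theorem det_unreduced_vs_reduced (F : Type*) [Field F] (t : F) (m : ℕ) (hm : 1 ≤ m)
    (ht : t ≠ 0) (htn : t ^ (m + 1) ≠ 1)
    (A : Matrix (Fin (m + 1)) (Fin (m + 1)) F) (B : Matrix (Fin m) (Fin m) F) (r : Fin m → F)
    (hA : (Cmat (m + 1) F)⁻¹ * A * Cmat (m + 1) F = blockMat B r)
    (hr : ∀ j, (1 - t ^ (m + 1)) * r j = ∑ i : Fin m, (t ^ ((i : ℕ) + 1) - 1) * (B - 1) i j) :
    (t ^ (-(m + 1 : ℤ)) - 1) * (A.submatrix Fin.castSucc Fin.castSucc - 1).det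
      = (t⁻¹ - 1) * (B - 1).det := by
  obtain ⟨p, rfl⟩ : ∃ p, m = p + 1 := ⟨m - 1, by omega⟩
  have hu : IsUnit (Cmat (p + 1 + 1) F).det := by simp [Cmat_det]
  have h1 : A * Cmat (p + 1 + 1) F = Cmat (p + 1 + 1) F * blockMat B r := by
    rw [← hA, Matrix.mul_assoc, Matrix.mul_nonsing_inv_cancel_left _ _ hu]
  have hq : (1 - t ^ (p + 1 + 1)) ≠ 0 := sub_ne_zero.mpr (Ne.symm htn)
  let w : Fin (p + 1) → F := fun i => (t ^ ((i : ℕ) + 1) - 1) / (1 - t ^ (p + 1 + 1))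
  let e : Fin (p + 1) → F := Pi.single (Fin.last p) 1
  have hw : r = Matrix.vecMul w (B - 1) := by
    funext j
    apply mul_left_cancel₀ hq
    rw [hr, Matrix.vecMul, dotProduct, Finset.mul_sum]
    refine Finset.sum_congr rfl fun i _ => ?_
    simp only [w]
    field_simp
  have hCe : Matrix.mulVec (Cmat (p + 1) F) e = fun _ => 1 := by
    funext i
    simp [e, Cmat, Fin.le_last]
  have h2 : A.submatrix Fin.castSucc Fin.castSucc * Cmat (p + 1) F
      = Cmat (p + 1) F * B + Matrix.vecMulVec (fun _ => 1) r := by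
    ext i j
    have h := congrFun (congrFun h1 i.castSucc) j.castSucc
    rw [Matrix.mul_apply, Matrix.mul_apply, Fin.sum_univ_castSucc (n := p + 1),
      Fin.sum_univ_castSucc (n := p + 1)] at h
    have hn : ¬ (Fin.last (p + 1) ≤ j.castSucc) := not_le.mpr (Fin.castSucc_lt_last j)
    have hb : ∀ x : Fin (p + 1), blockMat B r x.castSucc j.castSucc = B x j := by
      intro x
      have hx : ((x.castSucc : Fin (p + 1 + 1)) : ℕ) < p + 1 := x.isLt
      have hj : ((j.castSucc : Fin (p + 1 + 1)) : ℕ) < p + 1 := j.isLt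
      simp only [blockMat, Matrix.of_apply, dif_pos hx, dif_pos hj]
      rfl
    have hl : blockMat B r (Fin.last (p + 1)) j.castSucc = r j := by
      have hx : ¬ ((Fin.last (p + 1) : Fin (p + 1 + 1)) : ℕ) < p + 1 := by simp
      have hj : ((j.castSucc : Fin (p + 1 + 1)) : ℕ) < p + 1 := j.isLt
      simp only [blockMat, Matrix.of_apply, dif_neg hx, dif_pos hj]
      rfl
    simp only [hb, hl, Cmat, Matrix.of_apply, hn, Fin.castSucc_le_castSucc_iff, Fin.le_last,
      if_true, if_false, mul_zero, add_zero, one_mul, mul_ite, mul_one, ite_mul, zero_mul] at h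
    simp [Matrix.mul_apply, Cmat, Matrix.vecMulVec_apply, h]
  have h3 : (A.submatrix Fin.castSucc Fin.castSucc - 1) * Cmat (p + 1) F
      = Cmat (p + 1) F * ((1 + Matrix.vecMulVec e w) * (B - 1)) := by
    rw [sub_mul, h2, add_mul, Matrix.vecMulVec_mul, ← hw, mul_add, Matrix.mul_vecMulVec, hCe]
    simp only [mul_sub, one_mul, mul_one]
    abel
  have h4 := congrArg Matrix.det h3
  rw [Matrix.det_mul, Matrix.det_mul, Matrix.det_mul, Cmat_det, mul_one, one_mul,
    Matrix.vecMulVec_eq Unit, Matrix.det_one_add_replicateCol_mul_replicateRow] at h4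
  have h5 : w ⬝ᵥ e = (t ^ (p + 1) - 1) / (1 - t ^ (p + 1 + 1)) := by
    simp [e, w]
  have h6 : t ^ (-(((p + 1 : ℕ) : ℤ) + 1)) = (t ^ (p + 1 + 1))⁻¹ := by
    rw [zpow_neg]; norm_cast
  rw [h4, h5, h6, ← mul_assoc]
  congr 1
  field_simp
  ring
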